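/- arXiv:1305.5296 — 6 statements merged into one kernel-verified Lean document; each statement's English description precedes it below -/
import Mathlib

section
/- Let K be a field and L a finitely generated field extension of K (i.e. L is generated as a field over K by finitely many elements). Let I denote the diagonal ideal, the kernel of the multiplication map L ⊗_K L → L. Then for every x ∈ L, x belongs to the separable algebraic closure of K in L if and only if x ⊗ 1 − 1 ⊗ x lies in I^n for every n ≥ 1. Equivalently, the separable algebraic closure of K in L is the equalizer of the two natural maps from L to the I-adic completion of L ⊗_K L. -/
open scoped TensorProduct

open Polynomial in
/-- If `a` and `b` are roots of `f` and the derivative of `f` is a unit at `b`, then `a - b` is a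
multiple of its own square, so it lies in every power of an ideal which contains it. -/
theorem sub_mem_ideal_pow_of_aeval_eq_zero {K R : Type*} [CommRing K] [CommRing R] [Algebra K R]
    {f : K[X]} {a b : R} (ha : aeval a f = 0) (hb : aeval b f = 0)
    (hu : IsUnit (aeval b (derivative f))) {I : Ideal R} (hI : a - b ∈ I) (n : ℕ) :
    a - b ∈ I ^ n := by
  obtain ⟨k, hk⟩ := binomExpansion (f.map (algebraMap K R)) b (a - b)
  simp only [add_sub_cancel, derivative_map, eval_map_algebraMap, ha, hb, zero_add] at hk
  obtain ⟨u, hu⟩ := hu.exists_left_inv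
  have key : a - b = -(u * k) * (a - b) * (a - b) := by
    linear_combination (-(a - b)) * hu - u * hk
  induction n with
  | zero => simp
  | succ n ih =>
    rw [key, pow_succ]
    exact Ideal.mul_mem_mul (Ideal.mul_mem_left _ _ ih) hI

section

variable {K L : Type*} [Field K] [Field L] [Algebra K L]

/-- The intermediate field of those `y` for which `y ⊗ 1` and `1 ⊗ y` agree after multiplication
by `s`. -/
def tensorEqualizer (s : L ⊗[K] L) : IntermediateField K L where
  carrier := {y | ((1 : L) ⊗ₜ[K] y) * s = (y ⊗ₜ[K] (1 : L)) * s}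
  mul_mem' {a b} ha hb := by
    have h1 : (1 : L) ⊗ₜ[K] (a * b) = (1 ⊗ₜ a) * (1 ⊗ₜ b) := by simp
    have h2 : (a * b) ⊗ₜ[K] (1 : L) = (a ⊗ₜ 1) * (b ⊗ₜ 1) := by simp
    simp only [Set.mem_ofPred_eq] at *
    rw [h1, h2]
    linear_combination (1 ⊗ₜ[K] a) * hb + (b ⊗ₜ[K] 1) * ha
  add_mem' {a b} ha hb := by
    simp only [Set.mem_ofPred_eq] at *
    rw [TensorProduct.tmul_add, TensorProduct.add_tmul, add_mul, add_mul, ha, hb]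
  algebraMap_mem' r := by
    simp [Algebra.algebraMap_eq_smul_one, TensorProduct.smul_tmul]
  inv_mem' a ha := by
    rcases eq_or_ne a 0 with rfl | h0
    · simp
    have h1 : (1 ⊗ₜ a⁻¹ : L ⊗[K] L) * (1 ⊗ₜ a) = 1 := by
      simp [h0, Algebra.TensorProduct.one_def]
    have h2 : (a⁻¹ ⊗ₜ 1 : L ⊗[K] L) * (a ⊗ₜ 1) = 1 := by
      simp [h0, Algebra.TensorProduct.one_def]
    simp only [Set.mem_ofPred_eq] at *
    linear_combination (-(1 ⊗ₜ[K] a⁻¹) * (a⁻¹ ⊗ₜ[K] 1)) * ha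
      + (a⁻¹ ⊗ₜ[K] 1) * s * h1 - (1 ⊗ₜ[K] a⁻¹) * s * h2

theorem mem_tensorEqualizer {s : L ⊗[K] L} {y : L} :
    y ∈ tensorEqualizer s ↔ ((1 : L) ⊗ₜ[K] y) * s = (y ⊗ₜ[K] (1 : L)) * s :=
  Iff.rfl

/-- An element of `L ⊗[K] L` with nonzero product can be mapped to an element of `F ⊗[K] F` with
nonzero product by a pair of `F`-linear functionals on `L`. -/
theorem exists_lmul'_map_ne_zero (F : IntermediateField K L) {s : L ⊗[K] L}
    (hs : Algebra.TensorProduct.lmul' (S := L) K s ≠ 0) :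
    ∃ f g : L →ₗ[F] F, Algebra.TensorProduct.lmul' (S := F) K
      (TensorProduct.map (f.restrictScalars K) (g.restrictScalars K) s) ≠ 0 := by
  let b := Module.Basis.ofVectorSpace F L
  let q : L ⊗[K] L →ₗ[K] L ⊗[F] L := TensorProduct.lift
    (LinearMap.mk₂ K (fun x y ↦ x ⊗ₜ[F] y) (fun _ _ _ ↦ TensorProduct.add_tmul ..)
      (fun _ _ _ ↦ TensorProduct.smul_tmul' ..) (fun _ _ _ ↦ TensorProduct.tmul_add ..)
      (fun _ _ _ ↦ TensorProduct.tmul_smul ..))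
  have hq_tmul (x y : L) : q (x ⊗ₜ y) = x ⊗ₜ y := rfl
  have hq (s : L ⊗[K] L) : Algebra.TensorProduct.lmul' (S := L) F (q s) =
      Algebra.TensorProduct.lmul' (S := L) K s := by
    induction s with
    | zero => simp
    | tmul x y => simp [hq_tmul]
    | add x y hx hy => simp only [map_add, hx, hy]
  have hcoord (i j) (s : L ⊗[K] L) : (b.tensorProduct b).repr (q s) (i, j) =
      Algebra.TensorProduct.lmul' (S := F) K (TensorProduct.map
        ((b.coord i).restrictScalars K) ((b.coord j).restrictScalars K) s) := by
    induction s with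
    | zero => simp
    | tmul x y => simp [hq_tmul, Module.Basis.tensorProduct_repr_tmul_apply, mul_comm]
    | add x y hx hy => simp only [map_add, Finsupp.add_apply, hx, hy]
  by_contra! H
  apply hs
  have h0 : q s = 0 := (b.tensorProduct b).ext_elem fun ⟨i, j⟩ ↦ by
    rw [hcoord, H, map_zero, Finsupp.zero_apply]
  rw [← hq, h0, map_zero]

theorem map_one_tmul_mul (F : IntermediateField K L) (f g : L →ₗ[F] F) (y : F) (s : L ⊗[K] L) :
    TensorProduct.map (f.restrictScalars K) (g.restrictScalars K) ((1 ⊗ₜ (y : L)) * s) =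
      (1 ⊗ₜ y) * TensorProduct.map (f.restrictScalars K) (g.restrictScalars K) s := by
  induction s with
  | zero => simp
  | tmul a b =>
    have := g.map_smul y b
    rw [IntermediateField.smul_def, smul_eq_mul, smul_eq_mul] at this
    simp [this]
  | add a b ha hb => simp only [mul_add, map_add, ha, hb]

theorem map_tmul_one_mul (F : IntermediateField K L) (f g : L →ₗ[F] F) (y : F) (s : L ⊗[K] L) :
    TensorProduct.map (f.restrictScalars K) (g.restrictScalars K) (((y : L) ⊗ₜ 1) * s) =
      (y ⊗ₜ 1) * TensorProduct.map (f.restrictScalars K) (g.restrictScalars K) s := by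
  induction s with
  | zero => simp
  | tmul a b =>
    have := f.map_smul y a
    rw [IntermediateField.smul_def, smul_eq_mul, smul_eq_mul] at this
    simp [this]
  | add a b ha hb => simp only [mul_add, map_add, ha, hb]

theorem formallyUnramified_of_le_tensorEqualizer (F : IntermediateField K L)
    [Algebra.EssFiniteType K F] {s : L ⊗[K] L} (hF : F ≤ tensorEqualizer s)
    (hs : Algebra.TensorProduct.lmul' (S := L) K s ≠ 0) : Algebra.FormallyUnramified K F := by
  obtain ⟨f, g, h⟩ := exists_lmul'_map_ne_zero F hs
  set t := TensorProduct.map (f.restrictScalars K) (g.restrictScalars K) s with ht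
  refine Algebra.FormallyUnramified.iff_exists_tensorProduct.mpr
    ⟨((Algebra.TensorProduct.lmul' (S := F) K t)⁻¹ ⊗ₜ 1) * t, fun y ↦ ?_, ?_⟩
  · rw [mul_left_comm, sub_mul, ht, ← map_one_tmul_mul, ← map_tmul_one_mul,
      mem_tensorEqualizer.mp (hF y.2), sub_self, mul_zero]
  · rw [map_mul, Algebra.TensorProduct.lmul'_apply_tmul, mul_one, inv_mul_cancel₀ h]

theorem mem_separableClosure_of_mem_tensorEqualizer {s : L ⊗[K] L} {x : L}
    (hx : x ∈ tensorEqualizer s) (hs : Algebra.TensorProduct.lmul' (S := L) K s ≠ 0) :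
    x ∈ separableClosure K L := by
  let F := IntermediateField.adjoin K {x}
  have : Algebra.EssFiniteType K F :=
    IntermediateField.essFiniteType_iff.mpr ⟨{x}, by simp [F]⟩
  have := formallyUnramified_of_le_tensorEqualizer F
    (IntermediateField.adjoin_simple_le_iff.mpr hx) hs
  have := Algebra.FormallyUnramified.isSeparable K F
  exact mem_separableClosure_iff.mpr ((IntermediateField.isSeparable_adjoin_simple_iff_isSeparable
    K L).mp this)

theorem isNoetherianRing_tensorProduct_self (h : (⊤ : IntermediateField K L).FG) :
    IsNoetherianRing (L ⊗[K] L) := by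
  have := IntermediateField.essFiniteType_iff.mpr h
  have : Algebra.EssFiniteType K L :=
    .of_surjective IntermediateField.topEquiv.toAlgHom IntermediateField.topEquiv.surjective
  exact Algebra.EssFiniteType.isNoetherianRing L (L ⊗[K] L)

end

/-- For a finitely generated field extension `L/K`, an element `x ∈ L`
belongs to the separable algebraic closure of `K` in `L` if and only if
`x ⊗ 1 - 1 ⊗ x` lies in `I ^ n` for every `n ≥ 1`, where `I` is the diagonal ideal,
i.e. the kernel of the multiplication map `L ⊗[K] L → L`. -/
theorem stmt_0 (K L : Type*) [Field K] [Field L] [Algebra K L]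
    (hfg : (⊤ : IntermediateField K L).FG)
    (I : Ideal (L ⊗[K] L))
    (hI : I = RingHom.ker (Algebra.TensorProduct.lmul' (S := L) K))
    (x : L) :
    x ∈ separableClosure K L ↔
      ∀ n : ℕ, 1 ≤ n → (x ⊗ₜ[K] 1 - 1 ⊗ₜ[K] x : L ⊗[K] L) ∈ I ^ n := by
  constructor
  · intro hx n _
    have hsep : IsSeparable K x := mem_separableClosure_iff.mp hx
    refine sub_mem_ideal_pow_of_aeval_eq_zero (f := minpoly K x) ?_ ?_ ?_ ?_ n
    · change Polynomial.aeval (Algebra.TensorProduct.includeLeft (S := K) x) _ = 0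
      rw [Polynomial.aeval_algHom_apply, minpoly.aeval, map_zero]
    · change Polynomial.aeval (Algebra.TensorProduct.includeRight x) _ = 0
      rw [Polynomial.aeval_algHom_apply, minpoly.aeval, map_zero]
    · change IsUnit (Polynomial.aeval (Algebra.TensorProduct.includeRight x) _)
      rw [Polynomial.aeval_algHom_apply]
      exact (hsep.aeval_derivative_ne_zero (minpoly.aeval K x)).isUnit.map _
    · simp [hI, RingHom.mem_ker]
  · intro hx
    have := isNoetherianRing_tensorProduct_self hfg
    obtain ⟨r, hr⟩ := (I.mem_iInf_smul_pow_eq_bot_iff (x ⊗ₜ[K] 1 - 1 ⊗ₜ[K] x)).mp <| by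
      simp only [smul_eq_mul, Ideal.mul_top, Submodule.mem_iInf]
      intro n
      rcases n.eq_zero_or_pos with rfl | hn
      · simp
      · exact hx n hn
    have hr0 : Algebra.TensorProduct.lmul' (S := L) K r = 0 := by
      simpa [hI, RingHom.mem_ker] using r.2
    refine mem_separableClosure_of_mem_tensorEqualizer (s := 1 - (r : L ⊗[K] L)) ?_ (by simp [hr0])
    rw [mem_tensorEqualizer]
    rw [smul_eq_mul] at hr
    linear_combination hr
end

section
/- Let K be a field, d a natural number, and L = K(x₁,…,x_d) the purely transcendental extension of K given by the fraction field of the polynomial ring K[x₁,…,x_d]. Let I be the diagonal ideal, the kernel of the multiplication map L ⊗_K L → L. Then the intersection ⋂_{n≥1} I^n is the zero ideal. -/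
open scoped TensorProduct

/-- For a domain `S` over a field `K`, the base change to `S` of a fraction field of a polynomial
ring over `K` is a domain. -/
theorem isDomain_tensorProduct_fractionRing_mvPolynomial (K σ S L : Type*) [Field K]
    [CommRing S] [IsDomain S] [Algebra K S] [Field L] [Algebra K L]
    [Algebra (MvPolynomial σ K) L] [IsScalarTower K (MvPolynomial σ K) L]
    [IsFractionRing (MvPolynomial σ K) L] : IsDomain (S ⊗[K] L) := by
  have hdom : IsDomain (S ⊗[K] MvPolynomial σ K) :=
    (MvPolynomial.algebraTensorAlgEquiv (σ := σ) K S).toMulEquiv.isDomain (MvPolynomial σ S)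
  let i : MvPolynomial σ K →ₐ[K] S ⊗[K] MvPolynomial σ K := Algebra.TensorProduct.includeRight
  have hi : Function.Injective i :=
    Algebra.TensorProduct.includeRight_injective (algebraMap K S).injective
  let φ : S ⊗[K] MvPolynomial σ K →ₐ[S] S ⊗[K] L :=
    Algebra.TensorProduct.map (.id S S) (IsScalarTower.toAlgHom K (MvPolynomial σ K) L)
  let : Algebra (S ⊗[K] MvPolynomial σ K) (S ⊗[K] L) := φ.toAlgebra
  have : IsScalarTower S (S ⊗[K] MvPolynomial σ K) (S ⊗[K] L) :=
    .of_algebraMap_eq fun s ↦ (φ.commutes s).symm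
  have : IsLocalization ((nonZeroDivisors (MvPolynomial σ K)).map i) (S ⊗[K] L) := by
    refine IsLocalization.tensorProduct_tensorProduct_right K S _ L (RingHom.ext fun p ↦ ?_)
    change φ (1 ⊗ₜ p) = 1 ⊗ₜ algebraMap (MvPolynomial σ K) L p
    simp [φ]
  exact IsLocalization.isDomain_of_le_nonZeroDivisors _
    (map_le_nonZeroDivisors_of_injective i hi le_rfl)

/-- The tensor product of a ring essentially of finite type over a field `K` with a Noetherian
`K`-algebra is Noetherian. -/
theorem isNoetherianRing_tensorProduct_of_essFiniteType (K S T : Type*) [Field K]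
    [CommRing S] [Algebra K S] [IsNoetherianRing S] [CommRing T] [Algebra K T]
    [Algebra.EssFiniteType K T] : IsNoetherianRing (S ⊗[K] T) :=
  Algebra.EssFiniteType.isNoetherianRing S (S ⊗[K] T)

/-- Let `L = K(x₁,…,x_d)` be a purely transcendental extension of a field `K`,
i.e. the fraction field of the polynomial ring `K[x₁,…,x_d]`.  Let `I` be the diagonal ideal,
the kernel of the multiplication map `L ⊗[K] L → L`.  Then `⋂_{n ≥ 1} I ^ n = 0`. -/
theorem stmt_1 (K : Type*) [Field K] (d : ℕ) (L : Type*) [Field L]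
    [Algebra K L] [Algebra (MvPolynomial (Fin d) K) L]
    [IsScalarTower K (MvPolynomial (Fin d) K) L]
    [IsFractionRing (MvPolynomial (Fin d) K) L]
    (I : Ideal (L ⊗[K] L))
    (hI : I = RingHom.ker (Algebra.TensorProduct.lmul' (S := L) K)) :
    (⨅ n ∈ {n : ℕ | 1 ≤ n}, I ^ n) = ⊥ := by
  have hdom : IsDomain (L ⊗[K] L) :=
    isDomain_tensorProduct_fractionRing_mvPolynomial K (Fin d) L L
  have : Algebra.EssFiniteType (MvPolynomial (Fin d) K) L :=
    .of_isLocalization _ (nonZeroDivisors (MvPolynomial (Fin d) K))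
  have : Algebra.EssFiniteType K L := .comp K (MvPolynomial (Fin d) K) L
  have : IsNoetherianRing (L ⊗[K] L) := isNoetherianRing_tensorProduct_of_essFiniteType K L L
  have hne : I ≠ ⊤ := hI ▸ RingHom.ker_ne_top _
  rw [eq_bot_iff, ← I.iInf_pow_eq_bot_of_isDomain hne]
  refine le_iInf fun n ↦ ?_
  rcases n.eq_zero_or_pos with rfl | hn
  · simp
  · exact iInf₂_le n hn
end

section
/- Let L/K be a purely inseparable field extension. Then every element of the diagonal ideal I, the kernel of the multiplication map L ⊗_K L → L, is nilpotent; that is, I is contained in the nilradical of L ⊗_K L. -/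
open scoped TensorProduct

/-- If `L/K` is a purely inseparable field extension, then every element of
the diagonal ideal `I = ker (L ⊗[K] L → L)` is nilpotent, i.e. `I` is contained in the
nilradical of `L ⊗[K] L`. -/
theorem stmt_2 (K L : Type*) [Field K] [Field L] [Algebra K L]
    [IsPurelyInseparable K L]
    (I : Ideal (L ⊗[K] L))
    (hI : I = RingHom.ker (Algebra.TensorProduct.lmul' (S := L) K)) :
    I ≤ nilradical (L ⊗[K] L) := by
  obtain ⟨q, hq⟩ := ExpChar.exists K
  have : ExpChar (L ⊗[K] L) q :=
    expChar_of_injective_algebraMap (algebraMap K (L ⊗[K] L)).injective q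
  have hspan : I = Ideal.span (Set.range fun s : L => (1 : L) ⊗ₜ[K] s - s ⊗ₜ[K] (1 : L)) :=
    hI.trans (KaehlerDifferential.span_range_eq_ideal K L).symm
  rw [hspan, Ideal.span_le]
  rintro _ ⟨x, rfl⟩
  obtain ⟨n, y, hy⟩ := IsPurelyInseparable.pow_mem K q x
  refine mem_nilradical.mpr ⟨q ^ n, ?_⟩
  rw [sub_pow_expChar_pow, Algebra.TensorProduct.tmul_pow, Algebra.TensorProduct.tmul_pow,
    one_pow, ← hy, Algebra.TensorProduct.tmul_one_eq_one_tmul, sub_self]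
end

section
/- Let L/K be a finite purely inseparable field extension. Then L ⊗_K L is an Artinian local ring, its maximal ideal is the diagonal ideal I (the kernel of the multiplication map L ⊗_K L → L), the ideal I is nilpotent, and the residue field L ⊗_K L / I is isomorphic to L. -/
open scoped TensorProduct

/-- An element of the diagonal ideal of a purely inseparable extension is nilpotent. -/
theorem IsPurelyInseparable.isNilpotent_of_lmul'_eq_zero (K L : Type*) [Field K] [Field L]
    [Algebra K L] [IsPurelyInseparable K L] {x : L ⊗[K] L}
    (hx : Algebra.TensorProduct.lmul' (S := L) K x = 0) : IsNilpotent x := by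
  obtain ⟨n, hn, r, hr⟩ :=
    IsPurelyInseparable.exists_pow_mem_range_tensorProduct (k := K) (K := L) (R := L) x
  refine ⟨n, ?_⟩
  have h := congrArg (Algebra.TensorProduct.lmul' (S := L) K) hr
  have hr0 : r = 0 := by
    simpa [hx, hn.ne', Algebra.TensorProduct.algebraMap_apply] using h
  rw [← hr, hr0, map_zero]

/-- If `L/K` is a finite purely inseparable field extension, then
`L ⊗[K] L` is an Artinian local ring, its maximal ideal is the diagonal ideal
`I = ker (L ⊗[K] L → L)`, the ideal `I` is nilpotent, and the residue field
`(L ⊗[K] L) / I` is isomorphic to `L`. -/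
theorem stmt_3 (K L : Type*) [Field K] [Field L] [Algebra K L]
    [FiniteDimensional K L] [IsPurelyInseparable K L]
    (I : Ideal (L ⊗[K] L))
    (hI : I = RingHom.ker (Algebra.TensorProduct.lmul' (S := L) K)) :
    IsArtinianRing (L ⊗[K] L) ∧ IsLocalRing (L ⊗[K] L) ∧ I.IsMaximal ∧
      (∃ n : ℕ, 1 ≤ n ∧ I ^ n = ⊥) ∧
      Nonempty (((L ⊗[K] L) ⧸ I) ≃+* L) := by
  have hart : IsArtinianRing (L ⊗[K] L) := IsArtinianRing.of_finite K _
  have hsurj : Function.Surjective (Algebra.TensorProduct.lmul' (S := L) K) :=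
    fun a => ⟨a ⊗ₜ 1, by simp⟩
  have hmax : I.IsMaximal := hI ▸ RingHom.ker_isMaximal_of_surjective _ hsurj
  have hnil : I ≤ nilradical (L ⊗[K] L) := fun x hx =>
    IsPurelyInseparable.isNilpotent_of_lmul'_eq_zero K L (by simpa [hI, RingHom.mem_ker] using hx)
  have hloc : IsLocalRing (L ⊗[K] L) :=
    IsLocalRing.of_unique_max_ideal ⟨I, hmax, fun J hJ =>
      (hmax.eq_of_le hJ.ne_top (hnil.trans (nilradical_le_prime J))).symm⟩
  obtain ⟨n, hn⟩ := (Ideal.FG.isNilpotent_iff_le_nilradical (IsNoetherian.noetherian I)).mpr hnil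
  refine ⟨hart, hloc, hmax, ⟨n + 1, Nat.le_add_left 1 n, ?_⟩, ?_⟩
  · rw [pow_succ, hn, zero_mul, Ideal.zero_eq_bot]
  · subst hI
    exact ⟨RingHom.quotientKerEquivOfSurjective hsurj⟩
end

section
/- Let L/K be a separable algebraic field extension. Then the diagonal ideal I, the kernel of the multiplication map L ⊗_K L → L, is idempotent: I = I². -/
open scoped TensorProduct

/-- If `L/K` is a separable algebraic field extension, then the diagonal
ideal `I = ker (L ⊗[K] L → L)` is idempotent: `I = I²`. -/
theorem stmt_4 (K L : Type*) [Field K] [Field L] [Algebra K L]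
    [Algebra.IsAlgebraic K L] [Algebra.IsSeparable K L]
    (I : Ideal (L ⊗[K] L))
    (hI : I = RingHom.ker (Algebra.TensorProduct.lmul' (S := L) K)) :
    I = I ^ 2 := by
  have := Algebra.FormallyUnramified.of_isSeparable K L
  have h : IsIdempotentElem (KaehlerDifferential.ideal K L) :=
    (Ideal.cotangent_subsingleton_iff _).mp <| inferInstanceAs <| Subsingleton Ω[L⁄K]
  rw [hI, pow_two]
  exact h.symm
end

section
/- Let L/K be an arbitrary field extension and let x ∈ L be algebraic and separable over K. Then the element x ⊗ 1 − 1 ⊗ x of L ⊗_K L lies in I^n for every n ≥ 1, where I is the diagonal ideal, the kernel of the multiplication map L ⊗_K L → L. In particular, the two canonical maps from L to the I-adic completion of L ⊗_K L agree on every element of the separable algebraic closure of K in L. -/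
open scoped TensorProduct

/-- If `p` vanishes at `a` and `b` and `p'(b)` is a unit, then `a - b` is a multiple of its
square. -/
theorem sq_sub_dvd_sub_of_isUnit_aeval_derivative {R S : Type*} [CommRing R] [CommRing S]
    [Algebra R S] {p : Polynomial R} {a b : S} (ha : Polynomial.aeval a p = 0)
    (hb : Polynomial.aeval b p = 0) (hu : IsUnit (Polynomial.aeval b p.derivative)) :
    (a - b) ^ 2 ∣ a - b := by
  obtain ⟨k, hk⟩ := (p.map (algebraMap R S)).binomExpansion b (a - b)
  rw [add_sub_cancel, Polynomial.derivative_map] at hk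
  simp only [Polynomial.eval_map_algebraMap, ha, hb, zero_add] at hk
  rw [← hu.dvd_mul_left]
  exact ⟨-k, by linear_combination -hk⟩

theorem Ideal.mem_pow_of_sq_dvd_self {S : Type*} [CommRing S] {I : Ideal S} {d : S} (hd : d ∈ I)
    (h : d ^ 2 ∣ d) (n : ℕ) : d ∈ I ^ n := by
  induction n with
  | zero => simp
  | succ n ih =>
    refine Ideal.mem_of_dvd _ h ?_
    rw [sq, pow_succ]
    exact Ideal.mul_mem_mul ih hd

/-- Let `L/K` be an arbitrary field extension and `x ∈ L` an element
that is algebraic and separable over `K`.  Then `x ⊗ 1 - 1 ⊗ x ∈ I ^ n` for every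
`n ≥ 1`, where `I` is the diagonal ideal, the kernel of the multiplication map
`L ⊗[K] L → L`. -/
theorem stmt_5 (K L : Type*) [Field K] [Field L] [Algebra K L]
    (x : L) (hint : IsIntegral K x) (hsep : IsSeparable K x)
    (I : Ideal (L ⊗[K] L))
    (hI : I = RingHom.ker (Algebra.TensorProduct.lmul' (S := L) K)) :
    ∀ n : ℕ, 1 ≤ n → (x ⊗ₜ[K] 1 - 1 ⊗ₜ[K] x : L ⊗[K] L) ∈ I ^ n := by
  intro n _
  refine Ideal.mem_pow_of_sq_dvd_self (by simp [hI, RingHom.mem_ker]) ?_ n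
  let i₁ : L →ₐ[K] L ⊗[K] L := Algebra.TensorProduct.includeLeft
  let i₂ : L →ₐ[K] L ⊗[K] L := Algebra.TensorProduct.includeRight
  refine sq_sub_dvd_sub_of_isUnit_aeval_derivative (a := i₁ x) (b := i₂ x) (p := minpoly K x)
    ?_ ?_ ?_
  · rw [Polynomial.aeval_algHom_apply, minpoly.aeval, map_zero]
  · rw [Polynomial.aeval_algHom_apply, minpoly.aeval, map_zero]
  · rw [Polynomial.aeval_algHom_apply]
    exact (hsep.aeval_derivative_ne_zero (minpoly.aeval K x)).isUnit.map i₂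
end
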